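/- For every $x\in P$ the second (Fréchet) derivative of $S$ exists with operator norm $\|D^2S(x)\|=\frac{1}{4}|x|^{-3/2}$, and for every $R>0$ the function $x\mapsto\|D^2S(x)\|^2$ is NOT integrable on the cracked ball $B_R\setminus\{(\sigma,0):\sigma\le 0\}$, where $B_R:=\{x\in\mathbb{R}^2:|x|<R\}$ (so $S$ fails to belong to $H^2$ of the cracked ball). -/

import Mathlib

open MeasureTheory

/-- The plane (as the Euclidean plane) with the closed nonpositive `x₁`-axis removed. -/
def P : Set (EuclideanSpace ℝ (Fin 2)) := {x | x 1 ≠ 0 ∨ 0 < x 0}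

/-- `S(x₁,x₂) = (1/√2) · x₂ / √(|x| + x₁)` where `|x| = √(x₁² + x₂²)`. -/
noncomputable def S : EuclideanSpace ℝ (Fin 2) → ℝ := fun x =>
  (1 / Real.sqrt 2) * (x 1 / Real.sqrt (Real.sqrt ((x 0) ^ 2 + (x 1) ^ 2) + x 0))

/-- The open Euclidean ball of radius `R` centered at the origin. -/
def ball (R : ℝ) : Set (EuclideanSpace ℝ (Fin 2)) :=
  {x | Real.sqrt ((x 0) ^ 2 + (x 1) ^ 2) < R}

/-- The crack `{(σ,0) : σ ≤ 0}`. -/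
def crack : Set (EuclideanSpace ℝ (Fin 2)) := {x | x 1 = 0 ∧ x 0 ≤ 0}

/-- The Euclidean plane identified with `ℂ`. -/
noncomputable def toComplex : EuclideanSpace ℝ (Fin 2) ≃ₗᵢ[ℝ] ℂ :=
  Complex.orthonormalBasisOneI.repr.symm

lemma toComplex_re (x : EuclideanSpace ℝ (Fin 2)) : (toComplex x).re = x 0 := by
  simp [toComplex]

lemma toComplex_im (x : EuclideanSpace ℝ (Fin 2)) : (toComplex x).im = x 1 := by
  simp [toComplex]

lemma sqrt_sq_add_sq_eq_norm (x : EuclideanSpace ℝ (Fin 2)) :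
    √((x 0) ^ 2 + (x 1) ^ 2) = ‖x‖ := by
  simp [EuclideanSpace.norm_eq, Fin.sum_univ_two]

lemma mem_P_iff (x : EuclideanSpace ℝ (Fin 2)) : x ∈ P ↔ toComplex x ∈ Complex.slitPlane := by
  rw [Complex.mem_slitPlane_iff, toComplex_re, toComplex_im, or_comm]
  rfl

lemma isOpen_P : IsOpen P := by
  have : P = toComplex ⁻¹' Complex.slitPlane := Set.ext mem_P_iff
  rw [this]
  exact Complex.isOpen_slitPlane.preimage toComplex.continuous

lemma P_eq_compl_crack : P = crackᶜ := by
  ext x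
  simp only [P, crack, Set.mem_ofPred_eq, Set.mem_compl_iff, not_and_or, not_le, ne_eq]

/-- On the cracked plane, `S` is the imaginary part of the principal square root. -/
lemma S_eq_im_cpow {x : EuclideanSpace ℝ (Fin 2)} (hx : x ∈ P) :
    S x = (toComplex x ^ (2⁻¹ : ℂ)).im := by
  set z := toComplex x with hz
  set w := z ^ (2⁻¹ : ℂ) with hw
  have hre : w.re = √((‖z‖ + z.re) / 2) := Complex.cpow_inv_two_re z
  have hsq : w ^ 2 = z := Complex.cpow_ofNat_inv_pow z 2
  have him : z.im = 2 * w.re * w.im := by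
    rw [← hsq, sq, Complex.mul_im]; ring
  have hpos : 0 < ‖z‖ + z.re := by
    have hle := Complex.abs_re_le_norm z
    rcases Complex.mem_slitPlane_iff.1 ((mem_P_iff x).1 hx) with h | h
    · have := norm_nonneg z
      change 0 < z.re at h
      linarith
    · have := Complex.abs_re_lt_norm.2 h
      have := neg_abs_le z.re
      linarith
  have hre0 : 0 < w.re := by rw [hre]; positivity
  have hsum : √(‖z‖ + z.re) = √2 * w.re := by
    rw [hre, ← Real.sqrt_mul (by norm_num)]
    congr 1; ring
  rw [S, sqrt_sq_add_sq_eq_norm, ← toComplex_re, ← toComplex_im, ← toComplex.norm_map, ← hz, hsum,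
    him]
  have h2 : √2 * √2 = (2 : ℝ) := Real.mul_self_sqrt (by norm_num)
  field_simp
  rw [sq, h2]

/-- The functional `v ↦ Im (c v)` on the plane, as a continuous linear function of `c`. -/
noncomputable def imMul : ℂ →L[ℝ] EuclideanSpace ℝ (Fin 2) →L[ℝ] ℝ :=
  (ContinuousLinearMap.compL ℝ (EuclideanSpace ℝ (Fin 2)) ℂ ℝ Complex.imCLM) ∘L
    ((ContinuousLinearMap.compL ℝ (EuclideanSpace ℝ (Fin 2)) ℂ ℂ).flip
      (toComplex : EuclideanSpace ℝ (Fin 2) →L[ℝ] ℂ)) ∘L ContinuousLinearMap.mul ℝ ℂ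

lemma imMul_apply (c : ℂ) (v : EuclideanSpace ℝ (Fin 2)) :
    imMul c v = (c * toComplex v).im := rfl

lemma norm_imMul (c : ℂ) : ‖imMul c‖ = ‖c‖ := by
  apply le_antisymm
  · refine ContinuousLinearMap.opNorm_le_bound _ (norm_nonneg c) fun v => ?_
    rw [imMul_apply, Real.norm_eq_abs, ← toComplex.norm_map v, ← norm_mul]
    exact Complex.abs_im_le_norm _
  · rcases eq_or_ne c 0 with rfl | hc
    · simp
    have h := (imMul c).le_opNorm (toComplex.symm (Complex.I * (starRingEnd ℂ) c))
    have h1 : (c * (Complex.I * (starRingEnd ℂ) c)).im = ‖c‖ * ‖c‖ := by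
      rw [mul_left_comm, Complex.mul_conj, Complex.normSq_eq_norm_sq]
      simp [sq]
    rw [imMul_apply, toComplex.apply_symm_apply, h1, toComplex.symm.norm_map, norm_mul,
      norm_mul, norm_norm, Complex.norm_I, one_mul, RCLike.norm_conj] at h
    exact le_of_mul_le_mul_right h (norm_pos_iff.2 hc)

lemma hasFDerivAt_toComplex_cpow {x : EuclideanSpace ℝ (Fin 2)} (hx : x ∈ P) (a : ℂ) :
    HasFDerivAt (fun y => toComplex y ^ a)
      ((ContinuousLinearMap.mul ℝ ℂ (a * toComplex x ^ (a - 1))) ∘L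
        (toComplex : EuclideanSpace ℝ (Fin 2) →L[ℝ] ℂ)) x := by
  have h := ((Complex.hasStrictDerivAt_cpow_const (c := a)
    ((mem_P_iff x).1 hx)).hasDerivAt.hasFDerivAt.restrictScalars ℝ).comp x
      (toComplex : EuclideanSpace ℝ (Fin 2) →L[ℝ] ℂ).hasFDerivAt
  refine h.congr_fderiv ?_
  ext v
  simp [mul_comm]

lemma hasFDerivAt_S {x : EuclideanSpace ℝ (Fin 2)} (hx : x ∈ P) :
    HasFDerivAt S (imMul (2⁻¹ * toComplex x ^ ((2⁻¹ : ℂ) - 1))) x := by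
  have h := Complex.imCLM.hasFDerivAt.comp x (hasFDerivAt_toComplex_cpow hx 2⁻¹)
  refine HasFDerivAt.congr_of_eventuallyEq (h.congr_fderiv rfl) ?_
  filter_upwards [isOpen_P.mem_nhds hx] with y hy using S_eq_im_cpow hy

lemma hasFDerivAt_fderiv_S {x : EuclideanSpace ℝ (Fin 2)} (hx : x ∈ P) :
    HasFDerivAt (fderiv ℝ S)
      (imMul ∘L (ContinuousLinearMap.mul ℝ ℂ
        (2⁻¹ * (((2⁻¹ : ℂ) - 1) * toComplex x ^ ((2⁻¹ : ℂ) - 1 - 1)))) ∘L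
        (toComplex : EuclideanSpace ℝ (Fin 2) →L[ℝ] ℂ)) x := by
  have h := imMul.hasFDerivAt.comp x
    ((hasFDerivAt_toComplex_cpow hx (2⁻¹ - 1)).const_mul (2⁻¹ : ℂ))
  refine HasFDerivAt.congr_of_eventuallyEq (h.congr_fderiv ?_) ?_
  · ext v
    simp [mul_assoc]
  · filter_upwards [isOpen_P.mem_nhds hx] with y hy using (hasFDerivAt_S hy).fderiv

lemma norm_fderiv_fderiv_S {x : EuclideanSpace ℝ (Fin 2)} (hx : x ∈ P) :
    ‖fderiv ℝ (fderiv ℝ S) x‖ = (1 / 4) * ‖x‖ ^ (-(3 / 2) : ℝ) := by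
  rw [(hasFDerivAt_fderiv_S hx).fderiv]
  let imMulₗᵢ : ℂ →ₗᵢ[ℝ] EuclideanSpace ℝ (Fin 2) →L[ℝ] ℝ := ⟨imMul, norm_imMul⟩
  have hexp : (2⁻¹ : ℂ) - 1 - 1 = ((-(3 / 2) : ℝ) : ℂ) := by push_cast; norm_num
  calc _ = ‖(ContinuousLinearMap.mul ℝ ℂ
        (2⁻¹ * (((2⁻¹ : ℂ) - 1) * toComplex x ^ ((2⁻¹ : ℂ) - 1 - 1)))) ∘L
        (toComplex : EuclideanSpace ℝ (Fin 2) →L[ℝ] ℂ)‖ :=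
        imMulₗᵢ.norm_toContinuousLinearMap_comp
    _ = ‖2⁻¹ * (((2⁻¹ : ℂ) - 1) * toComplex x ^ ((2⁻¹ : ℂ) - 1 - 1))‖ := by
        rw [ContinuousLinearMap.opNorm_comp_linearIsometryEquiv,
          ContinuousLinearMap.opNorm_mul_apply]
    _ = _ := by
        rw [hexp, norm_mul, norm_mul, Complex.norm_cpow_real, toComplex.norm_map, ← mul_assoc]
        norm_num

lemma volume_crack : volume crack = 0 := by
  let L : Submodule ℝ (EuclideanSpace ℝ (Fin 2)) :=
    LinearMap.ker ((EuclideanSpace.proj 1 : EuclideanSpace ℝ (Fin 2) →L[ℝ] ℝ) :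
      EuclideanSpace ℝ (Fin 2) →ₗ[ℝ] ℝ)
  have hL : L ≠ ⊤ := by
    intro h
    have : EuclideanSpace.single (1 : Fin 2) (1 : ℝ) ∈ L := h ▸ Submodule.mem_top
    simp [L] at this
  refine measure_mono_null (fun x hx => ?_) (Measure.addHaar_submodule volume L hL)
  simpa [L] using hx.1

lemma ball_eq_metric_ball (R : ℝ) : ball R = Metric.ball 0 R := by
  ext x
  simp [ball, sqrt_sq_add_sq_eq_norm]

theorem not_integrableOn_sq_norm_fderiv_fderiv_S {R : ℝ} (hR : 0 < R) :
    ¬ IntegrableOn (fun x => ‖fderiv ℝ (fderiv ℝ S) x‖ ^ 2) (ball R \ crack) volume := by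
  intro h
  have hmeas : MeasurableSet (ball R) := ball_eq_metric_ball R ▸ measurableSet_ball
  have hdiff : ball R \ crack = ball R ∩ P := by rw [P_eq_compl_crack, Set.sdiff_eq]
  have h1 : IntegrableOn (fun x : EuclideanSpace ℝ (Fin 2) => (1 / 16) * ‖x‖ ^ (-3 : ℝ))
      (ball R) := by
    rw [← integrableOn_congr_set_ae (sdiff_null_ae_eq_self volume_crack)]
    refine h.congr_fun_ae ?_
    rw [hdiff]
    filter_upwards [ae_restrict_mem (hmeas.inter isOpen_P.measurableSet)] with x hx
    rw [norm_fderiv_fderiv_S hx.2, mul_pow, ← Real.rpow_mul_natCast (norm_nonneg x)]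
    norm_num
  rw [ball_eq_metric_ball, integrableOn_fun_norm_addHaar volume
    (f := fun r : ℝ => (1 / 16) * r ^ (-3 : ℝ))] at h1
  have h2 : IntegrableOn (fun r : ℝ => r ^ (-2 : ℝ)) (Set.Ioo 0 R) := by
    refine IntegrableOn.congr_fun (h1.const_mul 16) (fun r hr => ?_) measurableSet_Ioo
    have hexp : (-2 : ℝ) = 1 + -3 := by norm_num
    simp only [finrank_euclideanSpace, Fintype.card_fin, smul_eq_mul]
    rw [hexp, Real.rpow_add hr.1, Real.rpow_one]
    ring
  rw [intervalIntegral.integrableOn_Ioo_rpow_iff hR] at h2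
  norm_num at h2

/-- The second Fréchet derivative of `S` exists at every point of `P` with operator
norm `‖D²S(x)‖ = ¼ |x|^{-3/2}`, and for every `R > 0` the function `‖D²S‖²` is NOT
integrable on the cracked ball `B_R \ crack` (so `S ∉ H²` of the cracked ball). -/
theorem S_second_derivative_norm_and_not_integrable :
    (∀ x ∈ P, DifferentiableAt ℝ (fderiv ℝ S) x ∧
      ‖fderiv ℝ (fderiv ℝ S) x‖ =
        (1 / 4) * (Real.sqrt ((x 0) ^ 2 + (x 1) ^ 2)) ^ (-(3 / 2) : ℝ)) ∧
    (∀ R : ℝ, 0 < R →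
      ¬ IntegrableOn (fun x => ‖fderiv ℝ (fderiv ℝ S) x‖ ^ 2) (ball R \ crack) volume) := by
  refine ⟨fun x hx => ⟨(hasFDerivAt_fderiv_S hx).differentiableAt, ?_⟩,
    fun R hR => not_integrableOn_sq_norm_fderiv_fderiv_S hR⟩
  rw [sqrt_sq_add_sq_eq_norm]
  exact norm_fderiv_fderiv_S hx
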